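/- Assume the configuration setup below, and let x ∈ ℂⁿ satisfy sinh⟨γ,x⟩ ≠ 0 for every γ ∈ R₊. Suppose ψ₁, ψ₂ : ℂⁿ → ℂ are of the form ψᵢ(z) = Pᵢ(z)·exp⟨z,x⟩ where each Pᵢ ∈ ℂ[z₁,…,zₙ] has total degree N and homogeneous component of degree N equal to ∏_{γ∈R₊} ⟨γ,z⟩^{m_γ}, and both ψ₁ and ψ₂ satisfy the quasi-invariance conditions for (R₊, m). Then ψ₁ = ψ₂ (i.e., the Baker–Akhiezer function, if it exists, is unique). -/

import Mathlib

/-- The bilinear extension of the Euclidean inner product on `ℂⁿ`. -/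
noncomputable def bil {n : ℕ} (z w : Fin n → ℂ) : ℂ := ∑ i, z i * w i

/-- The linear form `z ↦ ⟨α, z⟩` as a polynomial in `z₁, …, zₙ`. -/
noncomputable def linForm {n : ℕ} (α : Fin n → ℂ) : MvPolynomial (Fin n) ℂ :=
  ∑ i, MvPolynomial.C (α i) * MvPolynomial.X i

/-- `ψ` satisfies the quasi-invariance conditions for the configuration
`(R₊, m)` (with derived multiplicities `m₂` for the doubled vectors). -/
def QuasiInv {n : ℕ} (R : Finset (Fin n → ℂ)) (mult mult2 : (Fin n → ℂ) → ℕ)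
    (ψ : (Fin n → ℂ) → ℂ) : Prop :=
  ∀ α ∈ R, (2⁻¹ : ℂ) • α ∉ R →
    ∀ s : ℕ,
      ((1 ≤ s ∧ s ≤ mult α) ∨ (∃ t : ℕ, 1 ≤ t ∧ t ≤ mult2 α ∧ s = mult α + 2 * t)) →
      ∀ z : Fin n → ℂ, bil α z = 0 →
        ψ (z + (s : ℂ) • α) = ψ (z - (s : ℂ) • α)

section
open Polynomial

lemma ba_comp_neg_X_coeff (p : ℂ[X]) (r : ℕ) :
    (p.comp (-X)).coeff r = (-1) ^ r * p.coeff r := by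
  have : (-X : ℂ[X]) = C (-1) * X := by simp
  rw [this, comp_C_mul_X_coeff, mul_comm]

lemma ba_U_coeff_parity (n r : ℕ) (h : ¬ Even (n + r)) :
    (Chebyshev.U ℂ (n : ℤ)).coeff r = 0 := by
  have h1 : (Chebyshev.U ℂ (n : ℤ)).comp (-X) = C ((-1 : ℂ) ^ n) * Chebyshev.U ℂ (n : ℤ) := by
    apply Polynomial.funext
    intro z
    rw [eval_comp, eval_neg, eval_X, Chebyshev.U_eval_neg, eval_mul, eval_C]
    congr 1
    simp [Int.negOnePow_def]
  have h2 := congrArg (fun p => p.coeff r) h1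
  simp only [ba_comp_neg_X_coeff, coeff_C_mul] at h2
  have h3 : ((-1 : ℂ) ^ r) = - (-1) ^ n := by
    rcases Nat.even_or_odd n with hn | hn <;> rcases Nat.even_or_odd r with hr | hr
    · exact absurd (hn.add hr) h
    · simp [hn.neg_one_pow, hr.neg_one_pow]
    · simp [hn.neg_one_pow, hr.neg_one_pow]
    · exact absurd (hn.add_odd hr) h
  rw [h3] at h2
  have h4 : ((-1 : ℂ) ^ n) ≠ 0 := by simp
  have h5 : (-1 : ℂ) ^ n * (Chebyshev.U ℂ (n : ℤ)).coeff r = 0 := by linear_combination (-1/2) * h2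
  exact (mul_eq_zero.mp h5).resolve_left h4

def baE (m i : ℕ) : ℕ := if i < m then i else m + 2 * (i - m) + 1

lemma baE_inj (m : ℕ) : Function.Injective (baE m) := by
  intro i j h
  unfold baE at h
  split_ifs at h <;> omega

/-- A combination of Chebyshev polynomials vanishing to high order is zero. -/
lemma ba_poly_zero (m l : ℕ) (c : Fin (m + l) → ℂ) (y : ℂ) (hy : 0 < l → y ≠ 0)
    (hdvd : (Polynomial.X - Polynomial.C y) ^ (m + l) ∣
      ∑ i, Polynomial.C (c i) * Polynomial.Chebyshev.U ℂ (baE m i : ℤ)) : c = 0 := by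
  set P := ∑ i, C (c i) * Chebyshev.U ℂ (baE m i : ℤ) with hP
  have hcoeff : ∀ r, P.coeff r = ∑ i, c i * (Chebyshev.U ℂ (baE m i : ℤ)).coeff r := by
    intro r; simp [hP, finsetSum_coeff]
  have hUdeg : ∀ n r : ℕ, n < r → (Chebyshev.U ℂ (n : ℤ)).coeff r = 0 := by
    intro n r h
    apply coeff_eq_zero_of_natDegree_lt
    rwa [Chebyshev.natDegree_U_natCast]
  set H := derivative^[m] P with hH
  have hHc : ∀ r, H.coeff r = (r + m).descFactorial m • P.coeff (r + m) := fun r =>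
    coeff_iterate_derivative P r
  have hHodd : H.comp (-X) = - H := by
    ext r
    rw [ba_comp_neg_X_coeff, coeff_neg]
    rcases Nat.even_or_odd r with hr | hr
    · have : H.coeff r = 0 := by
        rw [hHc, hcoeff, Finset.sum_eq_zero, smul_zero]
        intro i _
        by_cases hi : (i : ℕ) < m
        · rw [hUdeg _ _ (by unfold baE; rw [if_pos hi]; omega), mul_zero]
        · rw [ba_U_coeff_parity, mul_zero]
          unfold baE
          rw [if_neg hi]
          rw [Nat.even_iff] at hr ⊢
          omega
      simp [this]
    · simp [hr.neg_one_pow]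
  have hHdeg : H.degree < ((l + l : ℕ) : WithBot ℕ) := by
    rw [degree_lt_iff_coeff_zero]
    intro r hr
    rw [hHc, hcoeff, Finset.sum_eq_zero, smul_zero]
    intro i _
    have := i.2
    rw [hUdeg _ _ (by unfold baE; split_ifs <;> omega), mul_zero]
  have hd1 : (X - C y) ^ l ∣ H := by
    have := pow_sub_dvd_iterate_derivative_of_pow_dvd m hdvd
    simpa using this
  have hd2 : (X + C y) ^ l ∣ H := by
    obtain ⟨G, hG⟩ := hd1
    have h1 : H = - (((X - C y) ^ l) * G).comp (-X) := by rw [← hG, hHodd, neg_neg]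
    rw [h1, dvd_neg, mul_comp, pow_comp, sub_comp, X_comp, C_comp]
    apply Dvd.dvd.mul_right
    have : (-X - C y : ℂ[X]) = - (X + C y) := by ring
    rw [this, neg_pow]
    exact Dvd.intro_left _ rfl
  have hH0 : H = 0 := by
    by_contra hne
    have hl : 0 < l := by
      rcases Nat.eq_zero_or_pos l with h | h
      · subst h
        exact absurd (by simpa [Polynomial.degree_lt_iff_coeff_zero] using hHdeg) hne
      · exact h
    have hcop : IsCoprime ((X - C y) ^ l) ((X + C y) ^ l) := by
      apply IsCoprime.pow
      have : (X + C y : ℂ[X]) = X - C (-y) := by simp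
      rw [this]
      apply isCoprime_X_sub_C_of_isUnit_sub
      have := hy hl
      rw [sub_neg_eq_add, isUnit_iff_ne_zero, ← two_mul]
      exact mul_ne_zero two_ne_zero this
    have hdv := hcop.mul_dvd hd1 hd2
    have h3 := degree_le_of_dvd hdv hne
    rw [degree_mul, degree_pow, degree_pow, degree_X_sub_C, degree_X_add_C] at h3
    have h4 := lt_of_le_of_lt h3 hHdeg
    simp at h4
  have hPdeg : P.degree < (m : WithBot ℕ) := by
    rw [degree_lt_iff_coeff_zero]
    intro r hr
    obtain ⟨q, rfl⟩ := Nat.exists_eq_add_of_le' hr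
    have := hHc q
    rw [hH0, coeff_zero, nsmul_eq_mul] at this
    refine (mul_eq_zero.mp this.symm).resolve_left ?_
    intro h
    rw [Nat.cast_eq_zero, Nat.descFactorial_eq_zero_iff_lt] at h
    omega
  have hP0 : P = 0 := by
    by_contra hne
    have h3 := degree_le_of_dvd hdvd hne
    rw [degree_pow, degree_X_sub_C] at h3
    have h4 := lt_of_le_of_lt h3 hPdeg
    simp only [nsmul_eq_mul, mul_one] at h4
    have h5 : m + l < m := by exact_mod_cast h4
    omega
  let S : Polynomial.Sequence ℂ := ⟨fun n => Chebyshev.U ℂ (n : ℤ), fun n => Chebyshev.degree_U_natCast ℂ n⟩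
  have hli : LinearIndependent ℂ (fun i : Fin (m + l) => S (baE m i)) :=
    S.linearIndependent.comp (fun i : Fin (m + l) => baE m i)
      ((baE_inj m).comp Fin.val_injective)
  rw [Fintype.linearIndependent_iff] at hli
  ext i
  apply hli c
  rw [← hP0, hP]
  apply Finset.sum_congr rfl
  intro i _
  rw [Polynomial.smul_eq_C_mul]

noncomputable def baC (a : ℂ) (s j : ℕ) : ℂ :=
  (s : ℂ) ^ j * (Complex.exp (s * a) - (-1) ^ j * Complex.exp (-(s * a)))

lemma ba_iter {k : ℕ} (c : Fin k → ℂ) (s : Fin k → ℕ) (j : ℕ) :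
    iteratedDeriv j (fun w => ∑ i, c i * baC w (s i) 0) = fun w => ∑ i, c i * baC w (s i) j := by
  induction j with
  | zero => simp
  | succ j ih =>
    rw [iteratedDeriv_succ, ih]
    ext w
    apply HasDerivAt.deriv
    apply HasDerivAt.fun_sum
    intro i _
    apply HasDerivAt.const_mul
    unfold baC
    have h1 : HasDerivAt (fun w : ℂ => (s i : ℂ) * w) (s i) w := by
      simpa using (hasDerivAt_id w).const_mul (s i : ℂ)
    have h2 := ((h1.cexp).sub (((h1.neg).cexp).const_mul ((-1 : ℂ) ^ j))).const_mul ((s i : ℂ) ^ j)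
    have h3 : (s i : ℂ) ^ (j + 1) * (Complex.exp (s i * w) - (-1) ^ (j + 1) *
        Complex.exp (-(s i * w))) = (s i : ℂ) ^ j * (Complex.exp (s i * w) * s i -
        (-1) ^ j * (Complex.exp (-(s i * w)) * -(s i))) := by ring
    rw [h3]
    exact h2

lemma ba_wronskian (m l : ℕ) (a : ℂ) (ha : Complex.sinh a ≠ 0) (ha2 : 0 < l → Complex.cosh a ≠ 0)
    (c : Fin (m + l) → ℂ)
    (hc : ∀ j < m + l, ∑ i, c i * baC a (baE m i + 1) j = 0) : c = 0 := by
  apply ba_poly_zero m l c (Complex.cosh a) ha2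
  set P := ∑ i, C (c i) * Chebyshev.U ℂ (baE m i : ℤ) with hP
  by_cases hP0 : P = 0
  · rw [hP0]; exact dvd_zero _
  obtain ⟨G, hG, hGn⟩ := exists_eq_pow_rootMultiplicity_mul_and_not_dvd P hP0 (Complex.cosh a)
  set r := rootMultiplicity (Complex.cosh a) P
  suffices h : m + l ≤ r from (pow_dvd_pow _ h).trans (Dvd.intro _ hG.symm)
  have hGe : G.eval (Complex.cosh a) ≠ 0 := by
    intro h; exact hGn (dvd_iff_isRoot.mpr h)
  set f : ℂ → ℂ := fun w => ∑ i, c i * baC w (baE m i + 1) 0 with hf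
  have hfe : f = (fun w => Complex.cosh w - Complex.cosh a) ^ r *
      (fun w => 2 * Complex.sinh w * G.eval (Complex.cosh w)) := by
    ext w
    have h1 : f w = 2 * Complex.sinh w * P.eval (Complex.cosh w) := by
      rw [hP, eval_finsetSum, Finset.mul_sum, hf]
      apply Finset.sum_congr rfl
      intro i _
      have := Chebyshev.U_complex_cosh w (baE m i : ℤ)
      rw [eval_mul, eval_C]
      have h2 : baC w (baE m i + 1) 0 = 2 * Complex.sinh ((((baE m i : ℕ) : ℤ) + 1) * w) := by
        unfold baC; rw [Complex.sinh]; push_cast; ring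
      rw [h2, ← this]; ring
    rw [h1, hG]
    simp only [eval_mul, eval_pow, eval_sub, eval_X, eval_C, Pi.mul_apply, Pi.pow_apply]
    ring
  have hA1 : AnalyticAt ℂ (fun w => Complex.cosh w - Complex.cosh a) a :=
    (Complex.differentiable_cosh.sub_const _).analyticAt a
  have hA2 : AnalyticAt ℂ (fun w => 2 * Complex.sinh w * G.eval (Complex.cosh w)) a := by
    refine Differentiable.analyticAt ?_ a
    exact ((Complex.differentiable_sinh.const_mul 2)).mul (G.differentiable.comp Complex.differentiable_cosh)
  have hA : AnalyticAt ℂ f a := by rw [hfe]; exact (hA1.pow r).mul hA2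
  have ho : ((m + l : ℕ) : ℕ∞) ≤ analyticOrderAt f a := by
    rw [natCast_le_analyticOrderAt_iff_iteratedDeriv_eq_zero hA]
    intro j hj
    rw [hf, ba_iter c (fun i => baE m i + 1) j]
    exact hc j hj
  rw [hfe, analyticOrderAt_mul (hA1.pow r) hA2, analyticOrderAt_pow hA1,
    hA2.analyticOrderAt_eq_zero.mpr (by simp [ha, hGe]),
    hA1.analyticOrderAt_eq_one_of_zero_deriv_ne_zero (by simp) (by simpa using ha)] at ho
  simp only [nsmul_eq_mul, mul_one, add_zero] at ho
  exact_mod_cast ho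

lemma ba_kernel (m l : ℕ) (a : ℂ) (ha : Complex.sinh a ≠ 0) (ha2 : 0 < l → Complex.cosh a ≠ 0)
    (v : Fin (m + l) → ℂ)
    (hv : ∀ i : Fin (m + l), ∑ j : Fin (m + l), v j * baC a (baE m i + 1) j = 0) : v = 0 := by
  let M : Matrix (Fin (m + l)) (Fin (m + l)) ℂ := fun i j => baC a (baE m i + 1) j
  have hdet : M.det ≠ 0 := by
    intro h
    obtain ⟨c, hc, hc0⟩ := Matrix.exists_vecMul_eq_zero_iff.mpr h
    apply hc
    apply ba_wronskian m l a ha ha2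
    intro j hj
    exact congrFun hc0 ⟨j, hj⟩
  by_contra hne
  apply hdet
  apply Matrix.exists_mulVec_eq_zero_iff.mp
  refine ⟨v, hne, ?_⟩
  ext i
  rw [Pi.zero_apply, ← hv i]
  simp only [Matrix.mulVec, dotProduct, M]
  exact Finset.sum_congr rfl fun j _ => mul_comm _ _

end

section
open MvPolynomial

lemma ba_eval_linForm {n : ℕ} (α z : Fin n → ℂ) : eval z (linForm α) = bil α z := by
  simp [linForm, bil]

lemma ba_bil_comm {n : ℕ} (z w : Fin n → ℂ) : bil z w = bil w z := by
  simp [bil, mul_comm]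

lemma ba_bil_add {n : ℕ} (a z w : Fin n → ℂ) : bil a (z + w) = bil a z + bil a w := by
  simp [bil, mul_add, Finset.sum_add_distrib]

lemma ba_bil_smul {n : ℕ} (a z : Fin n → ℂ) (c : ℂ) : bil a (c • z) = c * bil a z := by
  simp only [bil, Pi.smul_apply, smul_eq_mul, Finset.mul_sum]
  exact Finset.sum_congr rfl fun i _ => by ring

/-- Restriction to the hyperplane orthogonal to `α`. -/
noncomputable def baProj {n : ℕ} (α : Fin n → ℂ) :
    MvPolynomial (Fin n) ℂ →ₐ[ℂ] MvPolynomial (Fin n) ℂ :=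
  aeval (fun i => X i - C (α i / bil α α) * linForm α)

lemma ba_dvd_sub_proj {n : ℕ} (α : Fin n → ℂ) (P : MvPolynomial (Fin n) ℂ) :
    linForm α ∣ P - baProj α P := by
  rw [← Ideal.mem_span_singleton, ← Ideal.Quotient.eq]
  have : (Ideal.Quotient.mkₐ ℂ (Ideal.span {linForm α})) =
      (Ideal.Quotient.mkₐ ℂ (Ideal.span {linForm α})).comp (baProj α) := by
    apply MvPolynomial.algHom_ext
    intro i
    simp only [baProj, AlgHom.comp_apply, aeval_X]
    rw [Ideal.Quotient.mkₐ_eq_mk, Ideal.Quotient.eq, Ideal.mem_span_singleton]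
    simp
  exact congrArg (fun f => f P) this

lemma ba_eval_proj {n : ℕ} (α : Fin n → ℂ) (P : MvPolynomial (Fin n) ℂ) (z : Fin n → ℂ) :
    eval z (baProj α P) = eval (z - (bil α z / bil α α) • α) P := by
  have : (MvPolynomial.aeval z : MvPolynomial (Fin n) ℂ →ₐ[ℂ] ℂ).comp (baProj α) =
      MvPolynomial.aeval (z - (bil α z / bil α α) • α) := by
    apply MvPolynomial.algHom_ext
    intro i
    have h := ba_eval_linForm α z
    simp only [baProj, AlgHom.comp_apply, aeval_X, map_sub, map_mul, aeval_eq_eval, eval_C,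
      Pi.sub_apply, Pi.smul_apply, smul_eq_mul, h]
    ring
  have h := congrArg (fun f => f P) this
  simpa [aeval_eq_eval] using h

lemma ba_bil_proj {n : ℕ} (α z : Fin n → ℂ) (hα : bil α α ≠ 0) :
    bil α (z - (bil α z / bil α α) • α) = 0 := by
  rw [sub_eq_add_neg, ← neg_smul, ba_bil_add, ba_bil_smul]
  field_simp
  ring

lemma ba_proj_self {n : ℕ} (α : Fin n → ℂ) (hα : bil α α ≠ 0) : baProj α (linForm α) = 0 := by
  apply MvPolynomial.funext
  intro z
  rw [ba_eval_proj, ba_eval_linForm, ba_bil_proj α z hα, map_zero]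

lemma ba_dvd_iff {n : ℕ} (α : Fin n → ℂ) (hα : bil α α ≠ 0) (P : MvPolynomial (Fin n) ℂ) :
    linForm α ∣ P ↔ baProj α P = 0 := by
  constructor
  · rintro ⟨G, rfl⟩
    rw [map_mul, ba_proj_self α hα, zero_mul]
  · intro h
    simpa [h] using ba_dvd_sub_proj α P

lemma ba_linForm_ne {n : ℕ} (α : Fin n → ℂ) (hα : bil α α ≠ 0) : linForm α ≠ 0 := by
  intro h
  apply hα
  rw [← ba_eval_linForm, h, map_zero]

lemma ba_prime {n : ℕ} (α : Fin n → ℂ) (hα : bil α α ≠ 0) : Prime (linForm α) := by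
  refine ⟨ba_linForm_ne α hα, ?_, ?_⟩
  · intro h
    have := (ba_dvd_iff α hα 1).mp h.dvd
    simp at this
  · intro P Q h
    rw [ba_dvd_iff α hα, map_mul, mul_eq_zero] at h
    rwa [ba_dvd_iff α hα, ba_dvd_iff α hα]

lemma ba_collinear {n : ℕ} (α β : Fin n → ℂ) (hα : bil α α ≠ 0) (h : linForm α ∣ linForm β) :
    ∃ c : ℂ, β = c • α := by
  rw [ba_dvd_iff α hα] at h
  refine ⟨bil β α / bil α α, ?_⟩
  ext i
  have h1 : eval (Pi.single i 1) (baProj α (linForm β)) = 0 := by rw [h, map_zero]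
  rw [ba_eval_proj, ba_eval_linForm, sub_eq_add_neg, ← neg_smul, ba_bil_add, ba_bil_smul] at h1
  have h2 : ∀ γ : Fin n → ℂ, bil γ (Pi.single i 1) = γ i := by
    intro γ; simp [bil, Pi.single_apply]
  rw [h2, h2] at h1
  simp only [Pi.smul_apply, smul_eq_mul]
  linear_combination h1

/-- The restriction of `P` to the line `y + t α`. -/
noncomputable def baLine {n : ℕ} (α y : Fin n → ℂ) :
    MvPolynomial (Fin n) ℂ →ₐ[ℂ] Polynomial ℂ :=
  aeval (fun i => Polynomial.C (α i) * Polynomial.X + Polynomial.C (y i))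

lemma ba_line_eval {n : ℕ} (α y : Fin n → ℂ) (P : MvPolynomial (Fin n) ℂ) (t : ℂ) :
    (baLine α y P).eval t = eval (y + t • α) P := by
  have : (Polynomial.aeval t : Polynomial ℂ →ₐ[ℂ] ℂ).comp (baLine α y) =
      MvPolynomial.aeval (y + t • α) := by
    apply MvPolynomial.algHom_ext
    intro i
    simp [baLine]
    ring
  have h : Polynomial.aeval t (baLine α y P) = MvPolynomial.aeval (y + t • α) P :=
    DFunLike.congr_fun this P
  rw [Polynomial.coe_aeval_eq_eval] at h
  rw [h, aeval_eq_eval]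

lemma ba_line_linForm {n : ℕ} (α y : Fin n → ℂ) (hy : bil α y = 0) :
    baLine α y (linForm α) = Polynomial.C (bil α α) * Polynomial.X := by
  apply Polynomial.funext
  intro t
  rw [ba_line_eval, ba_eval_linForm, ba_bil_add, ba_bil_smul, hy]
  rw [Polynomial.eval_mul, Polynomial.eval_C, Polynomial.eval_X, zero_add, mul_comm]

lemma ba_pow_dvd {n : ℕ} (α : Fin n → ℂ) (hα : bil α α ≠ 0) (P : MvPolynomial (Fin n) ℂ) (k : ℕ)
    (h : ∀ y, bil α y = 0 → Polynomial.X ^ k ∣ baLine α y P) : linForm α ^ k ∣ P := by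
  suffices H : ∀ j ≤ k, linForm α ^ j ∣ P from H k le_rfl
  intro j
  induction j with
  | zero => intro _; simp
  | succ j ih =>
    intro hj
    obtain ⟨G, hG⟩ := ih (by omega)
    have : linForm α ∣ G := by
      rw [ba_dvd_iff α hα]
      apply MvPolynomial.funext
      intro z
      rw [ba_eval_proj, map_zero]
      have hy := ba_bil_proj α z hα
      set y := z - (bil α z / bil α α) • α
      have h1 := (pow_dvd_pow Polynomial.X hj).trans (h y hy)
      rw [hG, map_mul, map_pow, ba_line_linForm α y hy, mul_pow, ← Polynomial.C_pow, mul_assoc,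
        Polynomial.X_pow_dvd_iff] at h1
      have h2 := h1 j (by omega)
      rw [Polynomial.coeff_C_mul, Polynomial.coeff_X_pow_mul', if_pos le_rfl, Nat.sub_self] at h2
      have h3 := (mul_eq_zero.mp h2).resolve_left (pow_ne_zero _ hα)
      rw [Polynomial.coeff_zero_eq_eval_zero, ba_line_eval] at h3
      simpa using h3
    obtain ⟨G', rfl⟩ := this
    exact ⟨G', by rw [hG]; ring⟩

lemma ba_hom_smul {n e : ℕ} (P : MvPolynomial (Fin n) ℂ) (hP : P.IsHomogeneous e) (T : ℂ)
    (z : Fin n → ℂ) : eval (T • z) P = T ^ e * eval z P := by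
  rw [eval_eq, eval_eq, Finset.mul_sum]
  apply Finset.sum_congr rfl
  intro d hd
  have h1 : ∑ i, d i = e := by
    have := hP.degree_eq_sum_deg_support hd
    rw [this]
    exact (Finset.sum_subset (Finset.subset_univ _) (by simp)).symm
  simp only [Pi.smul_apply, smul_eq_mul, mul_pow]
  rw [Finset.prod_mul_distrib]
  have h2 : ∏ i ∈ d.support, T ^ d i = T ^ e := by
    rw [← h1, Finset.prod_pow_eq_pow_sum]
    congr 1
    exact Finset.sum_subset (Finset.subset_univ _) (by simp)
  rw [h2]; ring

lemma ba_line_natDegree {n e : ℕ} (α y : Fin n → ℂ) (P : MvPolynomial (Fin n) ℂ)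
    (hP : P.IsHomogeneous e) : (baLine α y P).natDegree ≤ e := by
  have := MvPolynomial.aeval_natDegree_le P hP.totalDegree_le
    (fun i => Polynomial.C (α i) * Polynomial.X + Polynomial.C (y i)) (n := 1)
    (fun i => Polynomial.natDegree_linear_le)
  rw [mul_one] at this
  exact this

lemma ba_hom_line {n e : ℕ} (α y : Fin n → ℂ) (P : MvPolynomial (Fin n) ℂ)
    (hP : P.IsHomogeneous e) (T s : ℂ) (hT : T ≠ 0) :
    eval (T • y + s • α) P = ∑ j ∈ Finset.range (e + 1), (baLine α y P).coeff j * s ^ j * T ^ (e - j) := by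
  have h1 : T • y + s • α = T • (y + (s / T) • α) := by
    rw [smul_add, smul_smul, mul_div_cancel₀ _ hT]
  rw [h1, ba_hom_smul P hP, ← ba_line_eval,
    Polynomial.eval_eq_sum_range' (Nat.lt_succ_of_le (ba_line_natDegree α y P hP)), Finset.mul_sum]
  apply Finset.sum_congr rfl
  intro j hj
  have hj' : j ≤ e := by simpa [Nat.lt_succ_iff] using hj
  obtain ⟨q, rfl⟩ := Nat.exists_eq_add_of_le hj'
  rw [Nat.add_sub_cancel_left, pow_add, div_pow]
  field_simp

lemma ba_top_dvd {n m l : ℕ} (α x : Fin n → ℂ) (hα : bil α α ≠ 0)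
    (ha : Complex.sinh (bil α x) ≠ 0) (ha2 : 0 < l → Complex.cosh (bil α x) ≠ 0)
    (Q : MvPolynomial (Fin n) ℂ)
    (hQ : ∀ i < m + l, ∀ z, bil α z = 0 →
      eval (z + ((baE m i + 1 : ℕ) : ℂ) • α) Q * Complex.exp ((baE m i + 1 : ℕ) * bil α x) =
      eval (z - ((baE m i + 1 : ℕ) : ℂ) • α) Q * Complex.exp (-((baE m i + 1 : ℕ) * bil α x))) :
    linForm α ^ (m + l) ∣ homogeneousComponent Q.totalDegree Q := by
  apply ba_pow_dvd α hα
  intro y hy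
  set d := Q.totalDegree with hd
  set g : ℕ → Polynomial ℂ := fun e => baLine α y (homogeneousComponent e Q) with hg
  have hghom : ∀ e, (homogeneousComponent e Q).IsHomogeneous e := fun e =>
    homogeneousComponent_isHomogeneous e Q
  have hev : ∀ T s : ℂ, T ≠ 0 → eval (T • y + s • α) Q =
      ∑ e ∈ Finset.range (d + 1), ∑ j ∈ Finset.range (e + 1), (g e).coeff j * s ^ j * T ^ (e - j) := by
    intro T s hT
    conv_lhs => rw [← sum_homogeneousComponent Q]
    rw [map_sum]
    exact Finset.sum_congr rfl fun e _ => ba_hom_line α y _ (hghom e) T s hT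
  have key : ∀ i < m + l, ∑ e ∈ Finset.range (d + 1), ∑ j ∈ Finset.range (e + 1),
      Polynomial.C ((g e).coeff j * baC (bil α x) (baE m i + 1) j) * Polynomial.X ^ (e - j) = 0 := by
    intro i hi
    apply Polynomial.eq_zero_of_infinite_isRoot
    apply Set.Infinite.mono (s := {T : ℂ | T ≠ 0})
    · intro T hT
      have hT' : T ≠ 0 := hT
      have h1 := hQ i hi (T • y) (by rw [ba_bil_smul, hy, mul_zero])
      set s : ℕ := baE m i + 1
      rw [sub_eq_add_neg, ← neg_smul, hev T _ hT', hev T _ hT', ← sub_eq_zero, Finset.sum_mul,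
        Finset.sum_mul, ← Finset.sum_sub_distrib] at h1
      show Polynomial.eval T _ = 0
      rw [← h1, Polynomial.eval_finsetSum]
      apply Finset.sum_congr rfl
      intro e _
      rw [Polynomial.eval_finsetSum, Finset.sum_mul, Finset.sum_mul, ← Finset.sum_sub_distrib]
      apply Finset.sum_congr rfl
      intro j _
      simp only [Polynomial.eval_mul, Polynomial.eval_C, Polynomial.eval_pow, Polynomial.eval_X, baC]
      rw [neg_pow (s : ℂ) j]
      ring
    · exact (Set.finite_singleton (0 : ℂ)).infinite_compl
  rw [Polynomial.X_pow_dvd_iff]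
  intro i hi
  change (g d).coeff i = 0
  by_cases hid : d < i
  · exact Polynomial.coeff_eq_zero_of_natDegree_lt
      (lt_of_le_of_lt (ba_line_natDegree α y _ (hghom d)) hid)
  push Not at hid
  have hg0 : ∀ e, d < e → g e = 0 := by
    intro e he
    simp only [hg]
    rw [homogeneousComponent_eq_zero _ _ he, map_zero]
  have hv := ba_kernel m l (bil α x) ha ha2 (fun j => (g (d - i + j)).coeff j) (by
    intro r
    have h1 := congrArg (fun p => Polynomial.coeff p (d - i)) (key r r.2)
    simp only [Polynomial.finsetSum_coeff, Polynomial.coeff_C_mul_X_pow, Polynomial.coeff_zero] at h1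
    rw [← h1, Fin.sum_univ_eq_sum_range
      (fun j => (g (d - i + j)).coeff j * baC (bil α x) (baE m r + 1) j) (m + l)]
    have h2 : ∀ e ∈ Finset.range (d + 1), (∑ j ∈ Finset.range (e + 1),
        if d - i = e - j then (g e).coeff j * baC (bil α x) (baE m r + 1) j else 0) =
        ∑ j ∈ Finset.range (m + l),
        if e = d - i + j then (g e).coeff j * baC (bil α x) (baE m r + 1) j else 0 := by
      intro e he
      rw [← Finset.sum_filter, ← Finset.sum_filter]
      apply Finset.sum_congr _ (fun _ _ => rfl)
      ext j
      simp only [Finset.mem_filter, Finset.mem_range] at he ⊢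
      omega
    rw [Finset.sum_congr rfl h2, Finset.sum_comm]
    apply Finset.sum_congr rfl
    intro j _
    rw [Finset.sum_ite_eq' (Finset.range (d + 1)) (d - i + j)
      (fun e => (g e).coeff j * baC (bil α x) (baE m r + 1) j)]
    split_ifs with h
    · rfl
    · rw [hg0 _ (by simp at h; omega)]; simp)
  have := congrFun hv ⟨i, hi⟩
  simpa [Nat.sub_add_cancel hid] using this

end

lemma ba_top_ne {n : ℕ} (Q : MvPolynomial (Fin n) ℂ) (hQ : Q ≠ 0) :
    MvPolynomial.homogeneousComponent Q.totalDegree Q ≠ 0 := by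
  have hne : Q.support.Nonempty := MvPolynomial.support_nonempty.mpr hQ
  obtain ⟨d, hd, hd2⟩ := Finset.exists_mem_eq_sup Q.support hne (fun s => s.sum fun _ e => e)
  intro h
  have h1 := congrArg (fun p => MvPolynomial.coeff d p) h
  simp only [MvPolynomial.coeff_homogeneousComponent, MvPolynomial.coeff_zero] at h1
  rw [if_pos] at h1
  · exact (MvPolynomial.mem_support_iff.mp hd) h1
  · rw [MvPolynomial.totalDegree, hd2]; rfl

lemma ba_sum {n : ℕ} (R : Finset (Fin n → ℂ))
    (hR0 : ∀ γ ∈ R, bil γ γ ≠ 0)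
    (hRcol : ∀ γ ∈ R, ∀ δ ∈ R, γ ≠ δ → (∃ c : ℂ, δ = c • γ) →
      δ = (2 : ℂ) • γ ∨ γ = (2 : ℂ) • δ)
    (mult mult2 : (Fin n → ℂ) → ℕ)
    (hmult2 : ∀ α : Fin n → ℂ,
      ((2 : ℂ) • α ∈ R → mult2 α = mult ((2 : ℂ) • α)) ∧
      ((2 : ℂ) • α ∉ R → mult2 α = 0)) :
    ∑ γ ∈ R, mult γ ≤ ∑ α ∈ R with (2⁻¹ : ℂ) • α ∉ R, (mult α + mult2 α) := by
  classical
  have hne : ∀ γ ∈ R, γ ≠ 0 := by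
    rintro γ hγ rfl
    exact hR0 _ hγ (by simp [bil])
  have h2 : ∀ γ : Fin n → ℂ, (2 : ℂ) • (2⁻¹ : ℂ) • γ = γ := by
    intro γ; rw [smul_smul]; norm_num
  rw [← Finset.sum_filter_add_sum_filter_not R (fun α => (2⁻¹ : ℂ) • α ∉ R) mult,
    Finset.sum_add_distrib]
  gcongr ?_ + ?_
  · exact le_rfl
  have h1 : ∑ γ ∈ R with ¬ (2⁻¹ : ℂ) • γ ∉ R, mult γ =
      ∑ γ ∈ R with ¬ (2⁻¹ : ℂ) • γ ∉ R, mult2 ((2⁻¹ : ℂ) • γ) := by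
    apply Finset.sum_congr rfl
    intro γ hγ
    have hγR := (Finset.mem_filter.mp hγ).1
    rw [(hmult2 _).1 (by rwa [h2]), h2]
  rw [h1, ← Finset.sum_image (f := mult2) (g := fun γ => (2⁻¹ : ℂ) • γ)]
  · apply Finset.sum_le_sum_of_subset
    intro β hβ
    obtain ⟨γ, hγ, rfl⟩ := Finset.mem_image.mp hβ
    obtain ⟨hγR, hγ2⟩ := Finset.mem_filter.mp hγ
    rw [not_not] at hγ2
    refine Finset.mem_filter.mpr ⟨hγ2, fun h4 => ?_⟩
    have h0 := hne γ hγR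
    simp only [smul_smul] at h4
    have key : ∀ c : ℂ, c ≠ 0 → c • γ ≠ 0 := fun c hc => smul_ne_zero hc h0
    have hz : ∀ c e : ℂ, c • γ = e • γ → c = e := fun c e h => smul_left_injective ℂ h0 h
    rcases hRcol γ hγR _ h4 (fun h => by
      have := hz 1 _ ((one_smul ℂ γ).trans h)
      norm_num at this) ⟨_, rfl⟩ with h | h
    · have := hz _ _ h
      norm_num at this
    · rw [smul_smul] at h
      have := hz 1 _ ((one_smul ℂ γ).trans h)
      norm_num at this
  · intro a _ b _ h
    exact smul_right_injective _ (by norm_num : (2⁻¹ : ℂ) ≠ 0) h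

/-- Uniqueness of the Baker–Akhiezer function. -/
theorem stmt_4 (n : ℕ) (hn : 1 ≤ n)
    (R : Finset (Fin n → ℂ))
    (hR0 : ∀ γ ∈ R, bil γ γ ≠ 0)
    (hRcol : ∀ γ ∈ R, ∀ δ ∈ R, γ ≠ δ → (∃ c : ℂ, δ = c • γ) →
      δ = (2 : ℂ) • γ ∨ γ = (2 : ℂ) • δ)
    (mult mult2 : (Fin n → ℂ) → ℕ)
    (hmult : ∀ α ∈ R, (2⁻¹ : ℂ) • α ∉ R → 1 ≤ mult α)
    (hmult2 : ∀ α : Fin n → ℂ,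
      ((2 : ℂ) • α ∈ R → mult2 α = mult ((2 : ℂ) • α)) ∧
      ((2 : ℂ) • α ∉ R → mult2 α = 0))
    (N : ℕ) (hN : N = ∑ γ ∈ R, mult γ)
    (x : Fin n → ℂ) (hx : ∀ γ ∈ R, Complex.sinh (bil γ x) ≠ 0)
    (ψ₁ ψ₂ : (Fin n → ℂ) → ℂ)
    (P₁ P₂ : MvPolynomial (Fin n) ℂ)
    (hform₁ : ∀ z, ψ₁ z = MvPolynomial.eval z P₁ * Complex.exp (bil z x))
    (hform₂ : ∀ z, ψ₂ z = MvPolynomial.eval z P₂ * Complex.exp (bil z x))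
    (hdeg₁ : P₁.totalDegree = N) (hdeg₂ : P₂.totalDegree = N)
    (hhc₁ : MvPolynomial.homogeneousComponent N P₁ = ∏ γ ∈ R, linForm γ ^ mult γ)
    (hhc₂ : MvPolynomial.homogeneousComponent N P₂ = ∏ γ ∈ R, linForm γ ^ mult γ)
    (hquasi₁ : QuasiInv R mult mult2 ψ₁)
    (hquasi₂ : QuasiInv R mult mult2 ψ₂) :
    ψ₁ = ψ₂ := by
  suffices hPP : P₁ - P₂ = 0 by
    funext z
    rw [hform₁, hform₂, sub_eq_zero.mp hPP]
  by_contra hne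
  set Q := P₁ - P₂ with hQdef
  have htop := ba_top_ne Q hne
  have hdle : Q.totalDegree ≤ N := by
    refine (MvPolynomial.totalDegree_sub _ _).trans ?_
    rw [hdeg₁, hdeg₂, max_self]
  have hdlt : Q.totalDegree < N := by
    refine lt_of_le_of_ne hdle fun h => htop ?_
    rw [h, hQdef, map_sub, hhc₁, hhc₂, sub_self]
  set R' := R.filter (fun α => (2⁻¹ : ℂ) • α ∉ R) with hR'
  have hdvd : (∏ α ∈ R', linForm α ^ (mult α + mult2 α)) ∣
      MvPolynomial.homogeneousComponent Q.totalDegree Q := by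
    apply Finset.prod_dvd_of_isRelPrime
    · intro α hα β hβ hαβ
      obtain ⟨hαR, hα2⟩ := Finset.mem_filter.mp (Finset.mem_coe.mp hα)
      obtain ⟨hβR, hβ2⟩ := Finset.mem_filter.mp (Finset.mem_coe.mp hβ)
      apply IsRelPrime.pow
      rw [(ba_prime α (hR0 α hαR)).irreducible.isRelPrime_iff_not_dvd]
      intro hd
      have hhalf : ∀ γ : Fin n → ℂ, (2⁻¹ : ℂ) • (2 : ℂ) • γ = γ := by
        intro γ; rw [smul_smul]; norm_num
      rcases hRcol α hαR β hβR hαβ (ba_collinear α β (hR0 α hαR) hd) with h | h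
      · apply hβ2; rw [h, hhalf]; exact hαR
      · apply hα2; rw [h, hhalf]; exact hβR
    · intro α hα
      obtain ⟨hαR, hα2⟩ := Finset.mem_filter.mp hα
      apply ba_top_dvd α x (hR0 α hαR) (hx α hαR)
      · intro hl hc
        have h2R : (2 : ℂ) • α ∈ R := by
          by_contra h
          rw [(hmult2 α).2 h] at hl
          exact lt_irrefl _ hl
        apply hx _ h2R
        rw [ba_bil_comm, ba_bil_smul, ba_bil_comm, Complex.sinh_two_mul, hc, mul_zero]
      · intro i hi z hz
        have hs : (1 ≤ baE (mult α) i + 1 ∧ baE (mult α) i + 1 ≤ mult α) ∨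
            (∃ t : ℕ, 1 ≤ t ∧ t ≤ mult2 α ∧ baE (mult α) i + 1 = mult α + 2 * t) := by
          unfold baE
          split_ifs with h
          · left; omega
          · right; exact ⟨i - mult α + 1, by omega, by omega, by omega⟩
        have e1 := hquasi₁ α hαR hα2 _ hs z hz
        have e2 := hquasi₂ α hαR hα2 _ hs z hz
        set s : ℂ := ((baE (mult α) i + 1 : ℕ) : ℂ)
        have b1 : bil (z + s • α) x = bil z x + s * bil α x := by
          rw [ba_bil_comm, ba_bil_add, ba_bil_smul, ba_bil_comm x z, ba_bil_comm x α]
        have b2 : bil (z - s • α) x = bil z x + -(s * bil α x) := by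
          rw [sub_eq_add_neg, ← neg_smul, ba_bil_comm, ba_bil_add, ba_bil_smul, ba_bil_comm x z,
            ba_bil_comm x α, neg_mul]
        rw [hform₁, hform₁, b1, b2, Complex.exp_add, Complex.exp_add] at e1
        rw [hform₂, hform₂, b1, b2, Complex.exp_add, Complex.exp_add] at e2
        apply mul_left_cancel₀ (Complex.exp_ne_zero (bil z x))
        rw [hQdef, map_sub, map_sub]
        linear_combination e1 - e2
  have hprodhom : (∏ α ∈ R', linForm α ^ (mult α + mult2 α)).IsHomogeneous
      (∑ α ∈ R', (mult α + mult2 α)) := by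
    apply MvPolynomial.IsHomogeneous.prod
    intro α _
    have h1 : (linForm α).IsHomogeneous 1 := by
      apply MvPolynomial.IsHomogeneous.sum
      intro i _
      exact MvPolynomial.isHomogeneous_C_mul_X _ _
    simpa using h1.pow (mult α + mult2 α)
  have h1 := MvPolynomial.totalDegree_le_of_dvd_of_isDomain hdvd htop
  rw [hprodhom.totalDegree (ne_zero_of_dvd_ne_zero htop hdvd),
    (MvPolynomial.homogeneousComponent_isHomogeneous _ _).totalDegree htop] at h1
  have h2 := ba_sum R hR0 hRcol mult mult2 hmult2
  rw [← hN] at h2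
  exact lt_irrefl _ (lt_of_lt_of_le hdlt (h2.trans h1))
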